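/- Let T>0, let n≥1 be an integer and 0≤α≤1, let b:[0,T]→ℝ be nonnegative of class C^{n,α}, let a∈𝒢^s(ℝ) (s>1) be nonnegative, let 0<δ<1 and set κ̃=2δ/(n+α). Define T^{i}_{j}(t,x,ξ)=e^{∓Λ(t,x,ξ)}∂_ξ^{i}∂_x^{j}e^{±Λ(t,x,ξ)} (either fixed choice of sign). Then for all i,j,k,l∈ℕ there exists C>0, independent of μ∈(0,1] and t∈[0,T], such that for all t∈[0,T], x,ξ∈ℝ and 0<μ≤1: |∂_ξ^{k}∂_x^{l}T^{i}_{j}(t,x,ξ)| ≤ C·⟨ξ⟩_μ^{κ̃(i+j)}·φ(x,ξ)^{-(j+l)/2}·⟨ξ⟩_μ^{-(i+k)}. -/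

import Mathlib

open scoped ContDiff

open Set

/-- `⟨ξ⟩_μ = (μ⁻² + ξ²)^(1/2)` -/
noncomputable def br (μ ξ : ℝ) : ℝ := Real.sqrt (μ⁻¹ ^ 2 + ξ ^ 2)

/-- `φ(x,ξ) = a(x) + ⟨ξ⟩_μ^(-2δ)` -/
noncomputable def phi (a : ℝ → ℝ) (δ μ x ξ : ℝ) : ℝ := a x + br μ ξ ^ (-(2*δ))

/-- Gevrey class `𝒢^s(ℝ)` -/
def Gevrey (s : ℝ) (a : ℝ → ℝ) : Prop :=
  ContDiff ℝ ∞ a ∧ ∃ C₀ A₀ : ℝ, 0 < C₀ ∧ 0 < A₀ ∧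
    ∀ (x : ℝ) (k : ℕ), |iteratedDeriv k a x| ≤ C₀ * A₀ ^ k * (k.factorial : ℝ) ^ s

/-- `b` is of class `C^{n,α}` on `[0,T]`. -/
def CnAlpha (n : ℕ) (α T : ℝ) (b : ℝ → ℝ) : Prop :=
  ContDiffOn ℝ n b (Icc 0 T) ∧
    ∃ H : ℝ, ∀ t ∈ Icc (0:ℝ) T, ∀ t' ∈ Icc (0:ℝ) T,
      |iteratedDerivWithin n b (Icc 0 T) t - iteratedDerivWithin n b (Icc 0 T) t'| ≤
        H * |t - t'| ^ α

/-- `∂_ξ^i ∂_x^j f(x,ξ)` -/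
noncomputable def pdXiX (i j : ℕ) (f : ℝ → ℝ → ℝ) (x ξ : ℝ) : ℝ :=
  iteratedDeriv i (fun ξ' => iteratedDeriv j (fun x' => f x' ξ') x) ξ

/-- `Λ(t,x,ξ) = ∫₀ᵗ |b'(σ)| φ(x,ξ) / (b(σ) φ(x,ξ) + ⟨ξ⟩_μ^(-2δ)) dσ`,
with `b'` the derivative of `b` within `[0,T]`. -/
noncomputable def Lam (b a : ℝ → ℝ) (T δ μ t x ξ : ℝ) : ℝ :=
  ∫ σ in (0:ℝ)..t,
    |derivWithin b (Icc 0 T) σ| * phi a δ μ x ξ /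
      (b σ * phi a δ μ x ξ + br μ ξ ^ (-(2*δ)))

/-- `T^i_j = e^{-εΛ} ∂_ξ^i ∂_x^j e^{εΛ}` (sign `ε = ±1`). -/
noncomputable def Tij (b a : ℝ → ℝ) (T δ μ ε : ℝ) (i j : ℕ) (t x ξ : ℝ) : ℝ :=
  Real.exp (-(ε * Lam b a T δ μ t x ξ)) *
    pdXiX i j (fun x' ξ' => Real.exp (ε * Lam b a T δ μ t x' ξ')) x ξ


section SymCalc

variable {ι : Type*}

/-- x-derivative of a family -/
noncomputable def Dx (f : ι → ℝ → ℝ → ℝ) : ι → ℝ → ℝ → ℝ :=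
  fun i x ξ => deriv (fun x' => f i x' ξ) x

/-- ξ-derivative of a family -/
noncomputable def Dxi (f : ι → ℝ → ℝ → ℝ) : ι → ℝ → ℝ → ℝ :=
  fun i x ξ => deriv (fun ξ' => f i x ξ') ξ

def Bd (w f : ι → ℝ → ℝ → ℝ) : Prop := ∃ C : ℝ, 0 ≤ C ∧ ∀ i x ξ, |f i x ξ| ≤ C * w i x ξ

/-- symbol classes of finite order -/
def SymC (A B : ι → ℝ → ℝ → ℝ) : ℕ → (ι → ℝ → ℝ → ℝ) → (ι → ℝ → ℝ → ℝ) → Prop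
  | 0, w, f => Bd w f
  | N+1, w, f => Bd w f ∧ (∀ i x ξ, DifferentiableAt ℝ (fun x' => f i x' ξ) x) ∧
      (∀ i x ξ, DifferentiableAt ℝ (fun ξ' => f i x ξ') ξ) ∧
      SymC A B N (A * w) (Dx f) ∧ SymC A B N (B * w) (Dxi f)

variable {A B : ι → ℝ → ℝ → ℝ}

lemma SymC.bd {N : ℕ} {w f : ι → ℝ → ℝ → ℝ} (h : SymC A B N w f) : Bd w f := by
  cases N with
  | zero => exact h
  | succ N => exact h.1

lemma SymC.pred {N : ℕ} : ∀ {w f : ι → ℝ → ℝ → ℝ}, SymC A B (N+1) w f → SymC A B N w f := by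
  induction N with
  | zero => intro w f h; exact h.1
  | succ N ih => intro w f h; exact ⟨h.1, h.2.1, h.2.2.1, ih h.2.2.2.1, ih h.2.2.2.2⟩

lemma SymC.mono (hA : ∀ i x ξ, 0 ≤ A i x ξ) (hB : ∀ i x ξ, 0 ≤ B i x ξ) {N : ℕ} :
    ∀ {w w' f : ι → ℝ → ℝ → ℝ}, (∃ K : ℝ, 0 ≤ K ∧ ∀ i x ξ, w i x ξ ≤ K * w' i x ξ) →
    SymC A B N w f → SymC A B N w' f := by
  have key : ∀ {w w' f : ι → ℝ → ℝ → ℝ}, (∃ K : ℝ, 0 ≤ K ∧ ∀ i x ξ, w i x ξ ≤ K * w' i x ξ) →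
      Bd w f → Bd w' f := by
    rintro w w' f ⟨K, hK, hw⟩ ⟨C, hC, h⟩
    refine ⟨C * K, by positivity, fun i x ξ => (h i x ξ).trans ?_⟩
    rw [mul_assoc]
    exact mul_le_mul_of_nonneg_left (hw i x ξ) hC
  induction N with
  | zero => intro w w' f hw h; exact key hw h
  | succ N ih =>
    intro w w' f hw h
    refine ⟨key hw h.1, h.2.1, h.2.2.1, ih ?_ h.2.2.2.1, ih ?_ h.2.2.2.2⟩
    · obtain ⟨K, hK, hw⟩ := hw
      refine ⟨K, hK, fun i x ξ => ?_⟩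
      have := mul_le_mul_of_nonneg_left (hw i x ξ) (hA i x ξ)
      simp only [Pi.mul_apply]; linarith
    · obtain ⟨K, hK, hw⟩ := hw
      refine ⟨K, hK, fun i x ξ => ?_⟩
      have := mul_le_mul_of_nonneg_left (hw i x ξ) (hB i x ξ)
      simp only [Pi.mul_apply]; linarith

lemma SymC.add {N : ℕ} : ∀ {w f g : ι → ℝ → ℝ → ℝ}, SymC A B N w f → SymC A B N w g →
    SymC A B N w (f + g) := by
  have key : ∀ {w f g : ι → ℝ → ℝ → ℝ}, Bd w f → Bd w g → Bd w (f + g) := by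
    rintro w f g ⟨C, hC, h⟩ ⟨D, hD, h'⟩
    refine ⟨C + D, by positivity, fun i x ξ => ?_⟩
    have := abs_add_le (f i x ξ) (g i x ξ)
    have := h i x ξ
    have := h' i x ξ
    simp only [Pi.add_apply]
    linarith
  induction N with
  | zero => intro w f g h h'; exact key h h'
  | succ N ih =>
    intro w f g h h'
    refine ⟨key h.1 h'.1, fun i x ξ => (h.2.1 i x ξ).add (h'.2.1 i x ξ),
      fun i x ξ => (h.2.2.1 i x ξ).add (h'.2.2.1 i x ξ), ?_, ?_⟩
    · have e : Dx (f + g) = Dx f + Dx g := by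
        funext i x ξ; exact deriv_add (h.2.1 i x ξ) (h'.2.1 i x ξ)
      rw [e]; exact ih h.2.2.2.1 h'.2.2.2.1
    · have e : Dxi (f + g) = Dxi f + Dxi g := by
        funext i x ξ; exact deriv_add (h.2.2.1 i x ξ) (h'.2.2.1 i x ξ)
      rw [e]; exact ih h.2.2.2.2 h'.2.2.2.2

lemma SymC.mul {N : ℕ} : ∀ {w w' f g : ι → ℝ → ℝ → ℝ}, SymC A B N w f → SymC A B N w' g →
    SymC A B N (w * w') (f * g) := by
  have key : ∀ {w w' f g : ι → ℝ → ℝ → ℝ}, Bd w f → Bd w' g → Bd (w * w') (f * g) := by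
    rintro w w' f g ⟨C, hC, h⟩ ⟨D, hD, h'⟩
    refine ⟨C * D, by positivity, fun i x ξ => ?_⟩
    simp only [Pi.mul_apply, abs_mul]
    calc _ ≤ (C * w i x ξ) * (D * w' i x ξ) :=
          mul_le_mul (h i x ξ) (h' i x ξ) (abs_nonneg _) ((abs_nonneg _).trans (h i x ξ))
      _ = _ := by ring
  induction N with
  | zero => intro w w' f g h h'; exact key h h'
  | succ N ih =>
    intro w w' f g h h'
    refine ⟨key h.1 h'.1, fun i x ξ => (h.2.1 i x ξ).mul (h'.2.1 i x ξ),
      fun i x ξ => (h.2.2.1 i x ξ).mul (h'.2.2.1 i x ξ), ?_, ?_⟩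
    · have e : Dx (f * g) = Dx f * g + f * Dx g := by
        funext i x ξ; exact deriv_mul (h.2.1 i x ξ) (h'.2.1 i x ξ)
      rw [e]
      refine SymC.add ?_ ?_
      · rw [← mul_assoc]; exact ih h.2.2.2.1 h'.pred
      · rw [show A * (w * w') = w * (A * w') by ring]; exact ih h.pred h'.2.2.2.1
    · have e : Dxi (f * g) = Dxi f * g + f * Dxi g := by
        funext i x ξ; exact deriv_mul (h.2.2.1 i x ξ) (h'.2.2.1 i x ξ)
      rw [e]
      refine SymC.add ?_ ?_
      · rw [← mul_assoc]; exact ih h.2.2.2.2 h'.pred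
      · rw [show B * (w * w') = w * (B * w') by ring]; exact ih h.pred h'.2.2.2.2

lemma SymC.zero (hA : ∀ i x ξ, 0 ≤ A i x ξ) (hB : ∀ i x ξ, 0 ≤ B i x ξ) {N : ℕ} :
    ∀ {w : ι → ℝ → ℝ → ℝ}, (∀ i x ξ, 0 ≤ w i x ξ) → SymC A B N w (fun _ _ _ => 0) := by
  have key : ∀ {w : ι → ℝ → ℝ → ℝ}, (∀ i x ξ, 0 ≤ w i x ξ) → Bd w (fun _ _ _ => 0) := by
    intro w hw
    exact ⟨0, le_rfl, fun i x ξ => by simp⟩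
  induction N with
  | zero => intro w hw; exact key hw
  | succ N ih =>
    intro w hw
    refine ⟨key hw, fun i x ξ => by simp, fun i x ξ => by simp, ?_, ?_⟩
    · have e : Dx (fun (_ : ι) _ _ => (0:ℝ)) = fun _ _ _ => 0 := by funext i x ξ; simp [Dx]
      rw [e]; exact ih fun i x ξ => mul_nonneg (hA i x ξ) (hw i x ξ)
    · have e : Dxi (fun (_ : ι) _ _ => (0:ℝ)) = fun _ _ _ => 0 := by funext i x ξ; simp [Dxi]
      rw [e]; exact ih fun i x ξ => mul_nonneg (hB i x ξ) (hw i x ξ)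

lemma SymC.const (hA : ∀ i x ξ, 0 ≤ A i x ξ) (hB : ∀ i x ξ, 0 ≤ B i x ξ) {N : ℕ} (c : ℝ) :
    SymC A B N 1 (fun _ _ _ => c) := by
  have key : Bd (1 : ι → ℝ → ℝ → ℝ) (fun _ _ _ => c) :=
    ⟨|c|, abs_nonneg _, fun i x ξ => by simp⟩
  cases N with
  | zero => exact key
  | succ N =>
    refine ⟨key, fun i x ξ => by simp, fun i x ξ => by simp, ?_, ?_⟩
    · have e : Dx (fun (_ : ι) _ _ => c) = fun _ _ _ => 0 := by funext i x ξ; simp [Dx]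
      rw [e]; exact SymC.zero hA hB fun i x ξ => by simpa using hA i x ξ
    · have e : Dxi (fun (_ : ι) _ _ => c) = fun _ _ _ => 0 := by funext i x ξ; simp [Dxi]
      rw [e]; exact SymC.zero hA hB fun i x ξ => by simpa using hB i x ξ

lemma SymC.comp {u : ι → ℝ → ℝ → ℝ} (hu : ∀ i x ξ, 0 < u i x ξ) (hS : ∀ N, SymC A B N u u)
    (G : ℕ → ι → ℝ → ℝ)
    (hG : ∀ k i y, 0 < y → HasDerivAt (G k i) (G (k+1) i y) y)
    (W : ι → ℝ → ℝ → ℝ)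
    (hb : ∀ k, ∃ C : ℝ, 0 ≤ C ∧ ∀ i x ξ, |G k i (u i x ξ)| ≤ C * (W i x ξ * ((u i x ξ)⁻¹) ^ k)) :
    ∀ N k, SymC A B N (fun i x ξ => W i x ξ * ((u i x ξ)⁻¹) ^ k) (fun i x ξ => G k i (u i x ξ)) := by
  intro N
  induction N with
  | zero => intro k; exact hb k
  | succ N ih =>
    intro k
    have h1 : ∀ i x ξ, HasDerivAt (fun x' => G k i (u i x' ξ))
        (G (k+1) i (u i x ξ) * Dx u i x ξ) x := fun i x ξ =>
      (hG k i _ (hu i x ξ)).comp x ((hS 1).2.1 i x ξ).hasDerivAt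
    have h2 : ∀ i x ξ, HasDerivAt (fun ξ' => G k i (u i x ξ'))
        (G (k+1) i (u i x ξ) * Dxi u i x ξ) ξ := fun i x ξ =>
      (hG k i _ (hu i x ξ)).comp ξ ((hS 1).2.2.1 i x ξ).hasDerivAt
    refine ⟨hb k, fun i x ξ => (h1 i x ξ).differentiableAt,
      fun i x ξ => (h2 i x ξ).differentiableAt, ?_, ?_⟩
    · have e : Dx (fun i x ξ => G k i (u i x ξ)) =
          (fun i x ξ => G (k+1) i (u i x ξ)) * Dx u := by
        funext i x ξ; exact (h1 i x ξ).deriv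
      have e' : (A * fun i x ξ => W i x ξ * ((u i x ξ)⁻¹) ^ k) =
          (fun i x ξ => W i x ξ * ((u i x ξ)⁻¹) ^ (k+1)) * (A * u) := by
        funext i x ξ
        have := (hu i x ξ).ne'
        simp only [Pi.mul_apply, pow_succ]; field_simp
      rw [e, e']; exact SymC.mul (ih _) (hS (N+1)).2.2.2.1
    · have e : Dxi (fun i x ξ => G k i (u i x ξ)) =
          (fun i x ξ => G (k+1) i (u i x ξ)) * Dxi u := by
        funext i x ξ; exact (h2 i x ξ).deriv
      have e' : (B * fun i x ξ => W i x ξ * ((u i x ξ)⁻¹) ^ k) =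
          (fun i x ξ => W i x ξ * ((u i x ξ)⁻¹) ^ (k+1)) * (B * u) := by
        funext i x ξ
        have := (hu i x ξ).ne'
        simp only [Pi.mul_apply, pow_succ]; field_simp
      rw [e, e']; exact SymC.mul (ih _) (hS (N+1)).2.2.2.2

lemma pdXiX_eq (k l : ℕ) (f : ι → ℝ → ℝ → ℝ) (i : ι) (x ξ : ℝ) :
    pdXiX k l (f i) x ξ = (Dxi^[k] (Dx^[l] f)) i x ξ := by
  have h1 : ∀ l, ∀ i x ξ, iteratedDeriv l (fun x' => f i x' ξ) x = (Dx^[l] f) i x ξ := by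
    intro l
    induction l with
    | zero => intro i x ξ; simp
    | succ l ih =>
      intro i x ξ
      rw [iteratedDeriv_succ, Function.iterate_succ_apply', Dx]
      congr 1; funext x'; exact ih i x' ξ
  have h2 : ∀ k, ∀ g : ι → ℝ → ℝ → ℝ, ∀ i x ξ,
      iteratedDeriv k (fun ξ' => g i x ξ') ξ = (Dxi^[k] g) i x ξ := by
    intro k g
    induction k with
    | zero => intro i x ξ; simp
    | succ l ih =>
      intro i x ξ
      rw [iteratedDeriv_succ, Function.iterate_succ_apply', Dxi]
      congr 1; funext x'; exact ih i x x'
  rw [pdXiX, ← h2]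
  congr 1; funext ξ'; exact h1 l i x ξ'

lemma SymC.iter_x {w f : ι → ℝ → ℝ → ℝ} (h : ∀ N, SymC A B N w f) (l : ℕ) :
    ∀ N, SymC A B N (A ^ l * w) (Dx^[l] f) := by
  induction l with
  | zero => simpa using h
  | succ l ih =>
    intro N
    rw [Function.iterate_succ_apply', pow_succ', mul_assoc]
    exact (ih (N+1)).2.2.2.1

lemma SymC.iter_xi {w f : ι → ℝ → ℝ → ℝ} (h : ∀ N, SymC A B N w f) (l : ℕ) :
    ∀ N, SymC A B N (B ^ l * w) (Dxi^[l] f) := by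
  induction l with
  | zero => simpa using h
  | succ l ih =>
    intro N
    rw [Function.iterate_succ_apply', pow_succ', mul_assoc]
    exact (ih (N+1)).2.2.2.2

/-- conjugation by the exponential -/
lemma SymC.conj (hA : ∀ i x ξ, 0 ≤ A i x ξ) (hB : ∀ i x ξ, 0 ≤ B i x ξ)
    {R L : ι → ℝ → ℝ → ℝ} (hR : ∀ i x ξ, 1 ≤ R i x ξ) (hL : ∀ N, SymC A B N R L) (p q : ℕ) :
    ∀ N, SymC A B N (R ^ (p + q) * A ^ q * B ^ p)
      (fun i x ξ => Real.exp (-(L i x ξ)) *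
        (Dxi^[p] (Dx^[q] (fun i x ξ => Real.exp (L i x ξ)))) i x ξ) := by
  set E : ι → ℝ → ℝ → ℝ := fun i x ξ => Real.exp (L i x ξ) with hE
  have step : ∀ (w U : ι → ℝ → ℝ → ℝ), (∀ i x ξ, 0 ≤ w i x ξ) → (∀ N, SymC A B N w U) →
      (∀ N, SymC A B N (R * A * w) (Dx U + Dx L * U)) ∧ Dx (E * U) = E * (Dx U + Dx L * U) := by
    intro w U hw hU
    constructor
    · intro N
      refine SymC.add ?_ ?_
      · refine SymC.mono hA hB ⟨1, zero_le_one, fun i x ξ => ?_⟩ (hU (N+1)).2.2.2.1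
        have := mul_le_mul_of_nonneg_right (hR i x ξ) (mul_nonneg (hA i x ξ) (hw i x ξ))
        simp only [Pi.mul_apply]; linarith
      · rw [show R * A * w = (A * R) * w by ring]
        exact SymC.mul (hL (N+1)).2.2.2.1 (hU N)
    · funext i x ξ
      have h1 := ((hL 1).2.1 i x ξ).hasDerivAt.exp
      have h2 := ((hU 1).2.1 i x ξ).hasDerivAt
      have := (h1.mul h2).deriv
      simp only [Pi.mul_apply, Pi.add_apply]
      refine this.trans ?_
      simp only [Dx, hE]; ring
  have stepxi : ∀ (w U : ι → ℝ → ℝ → ℝ), (∀ i x ξ, 0 ≤ w i x ξ) → (∀ N, SymC A B N w U) →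
      (∀ N, SymC A B N (R * B * w) (Dxi U + Dxi L * U)) ∧
        Dxi (E * U) = E * (Dxi U + Dxi L * U) := by
    intro w U hw hU
    constructor
    · intro N
      refine SymC.add ?_ ?_
      · refine SymC.mono hA hB ⟨1, zero_le_one, fun i x ξ => ?_⟩ (hU (N+1)).2.2.2.2
        have := mul_le_mul_of_nonneg_right (hR i x ξ) (mul_nonneg (hB i x ξ) (hw i x ξ))
        simp only [Pi.mul_apply]; linarith
      · rw [show R * B * w = (B * R) * w by ring]
        exact SymC.mul (hL (N+1)).2.2.2.2 (hU N)
    · funext i x ξ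
      have h1 := ((hL 1).2.2.1 i x ξ).hasDerivAt.exp
      have h2 := ((hU 1).2.2.1 i x ξ).hasDerivAt
      have := (h1.mul h2).deriv
      simp only [Pi.mul_apply, Pi.add_apply]
      refine this.trans ?_
      simp only [Dxi, hE]; ring
  have hR0 : ∀ i x ξ, 0 ≤ R i x ξ := fun i x ξ => zero_le_one.trans (hR i x ξ)
  have hx : ∀ q, ∃ U, (∀ N, SymC A B N (R ^ q * A ^ q) U) ∧ Dx^[q] E = E * U := by
    intro q
    induction q with
    | zero =>
      refine ⟨1, fun N => ?_, by simp⟩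
      rw [pow_zero, pow_zero, mul_one]; exact SymC.const hA hB (N := N) 1
    | succ q ih =>
      obtain ⟨U, h1, h2⟩ := ih
      have := step _ U (fun i x ξ => by
        simp only [Pi.mul_apply, Pi.pow_apply]
        exact mul_nonneg (pow_nonneg (hR0 _ _ _) _) (pow_nonneg (hA _ _ _) _)) h1
      refine ⟨Dx U + Dx L * U, fun N => ?_, ?_⟩
      · rw [show R ^ (q+1) * A ^ (q+1) = R * A * (R ^ q * A ^ q) by ring]
        exact this.1 N
      · rw [Function.iterate_succ_apply', h2]; exact this.2
  have hxi : ∀ p, ∃ U, (∀ N, SymC A B N (R ^ (p + q) * A ^ q * B ^ p) U) ∧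
      Dxi^[p] (Dx^[q] E) = E * U := by
    intro p
    induction p with
    | zero =>
      simpa using hx q
    | succ p ih =>
      obtain ⟨U, h1, h2⟩ := ih
      have := stepxi _ U (fun i x ξ => by
        simp only [Pi.mul_apply, Pi.pow_apply]
        exact mul_nonneg (mul_nonneg (pow_nonneg (hR0 _ _ _) _) (pow_nonneg (hA _ _ _) _))
          (pow_nonneg (hB _ _ _) _)) h1
      refine ⟨Dxi U + Dxi L * U, fun N => ?_, ?_⟩
      · rw [show R ^ (p+1+q) * A ^ q * B ^ (p+1) = R * B * (R ^ (p+q) * A ^ q * B ^ p) by ring]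
        exact this.1 N
      · rw [Function.iterate_succ_apply', h2]; exact this.2
  obtain ⟨U, h1, h2⟩ := hxi p
  intro N
  have e : (fun i x ξ => Real.exp (-(L i x ξ)) * (Dxi^[p] (Dx^[q] E)) i x ξ) = U := by
    rw [h2]; funext i x ξ
    simp only [Pi.mul_apply, hE, ← mul_assoc, ← Real.exp_add]
    simp
  rw [e]; exact h1 N

end SymCalc

section Osc

lemma poly_antideriv (D : Polynomial ℝ) (m : ℕ) (hD : D.natDegree ≤ m) (p c : ℝ) :
    ∃ P : Polynomial ℝ, P.natDegree ≤ m + 1 ∧ Polynomial.derivative P = D ∧ P.eval p = c := by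
  set Q : Polynomial ℝ := ∑ i ∈ Finset.range (m+1),
    Polynomial.C (D.coeff i / ((i:ℝ)+1)) * Polynomial.X ^ (i+1) with hQ
  have hQd : Q.natDegree ≤ m + 1 := by
    refine Polynomial.natDegree_sum_le_of_forall_le _ _ fun i hi => ?_
    refine (Polynomial.natDegree_C_mul_X_pow_le _ _).trans ?_
    have := Finset.mem_range.1 hi
    omega
  have hQ' : Polynomial.derivative Q = D := by
    conv_rhs => rw [D.as_sum_range_C_mul_X_pow' (Nat.lt_succ_of_le hD)]
    rw [hQ, Polynomial.derivative_sum]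
    refine Finset.sum_congr rfl fun i _ => ?_
    rw [Polynomial.derivative_C_mul_X_pow]
    have : ((i:ℝ)+1) ≠ 0 := by positivity
    congr 2
    push_cast
    field_simp
  refine ⟨Q + Polynomial.C (c - Q.eval p), ?_, ?_, ?_⟩
  · exact (Polynomial.natDegree_add_le _ _).trans (by simp [hQd])
  · simp [hQ']
  · simp

lemma antideriv_step {T : ℝ} {f : ℝ → ℝ} (hf : DifferentiableOn ℝ f (Icc 0 T))
    {H β : ℝ} (hH : 0 ≤ H) (hβ : 0 ≤ β) {p : ℝ} (hp : 0 ≤ p) (D : Polynomial ℝ) (m : ℕ)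
    (hD : D.natDegree ≤ m)
    (hb : ∀ t ∈ Icc p T, |derivWithin f (Icc 0 T) t - D.eval t| ≤ H * (t - p) ^ β) :
    ∃ P : Polynomial ℝ, P.natDegree ≤ m + 1 ∧ Polynomial.derivative P = D ∧
      ∀ t ∈ Icc p T, |f t - P.eval t| ≤ H * (t - p) ^ (β + 1) := by
  obtain ⟨P, h1, h2, h3⟩ := poly_antideriv D m hD p (f p)
  refine ⟨P, h1, h2, fun t ht => ?_⟩
  have hsub : Icc p t ⊆ Icc 0 T := Icc_subset_Icc hp ht.2
  have key := (convex_Icc p t).norm_image_sub_le_of_norm_hasDerivWithin_le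
    (f := fun y => f y - P.eval y) (f' := fun y => derivWithin f (Icc 0 T) y - D.eval y)
    (C := H * (t - p) ^ β) (x := p) (y := t) ?_ ?_ (left_mem_Icc.2 ht.1) (right_mem_Icc.2 ht.1)
  · simp only [h3, sub_self, sub_zero, Real.norm_eq_abs] at key
    refine key.trans (le_of_eq ?_)
    rw [abs_of_nonneg (sub_nonneg.2 ht.1), Real.rpow_add_one' (sub_nonneg.2 ht.1) (by positivity),
      mul_assoc]
  · intro y hy
    have e1 := ((hf y (hsub hy)).hasDerivWithinAt).mono hsub
    have e2 := (P.hasDerivAt y).hasDerivWithinAt (s := Icc p t)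
    rw [h2] at e2
    exact e1.sub e2
  · intro y hy
    refine (hb y ⟨hy.1, hy.2.trans ht.2⟩).trans ?_
    have := Real.rpow_le_rpow (sub_nonneg.2 hy.1) (sub_le_sub_right hy.2 p) hβ
    exact mul_le_mul_of_nonneg_left this hH

lemma poly_approx {T : ℝ} (hT : 0 < T) {H α : ℝ} (hH : 0 ≤ H) (hα : 0 ≤ α) (m : ℕ) :
    ∀ f : ℝ → ℝ, ContDiffOn ℝ m f (Icc 0 T) →
    (∀ t ∈ Icc (0:ℝ) T, ∀ t' ∈ Icc (0:ℝ) T,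
      |iteratedDerivWithin m f (Icc 0 T) t - iteratedDerivWithin m f (Icc 0 T) t'| ≤
        H * |t - t'| ^ α) → ∀ p ∈ Icc (0:ℝ) T,
    ∃ D : Polynomial ℝ, D.natDegree ≤ m ∧
      ∀ t ∈ Icc p T, |f t - D.eval t| ≤ H * (t - p) ^ ((m:ℝ) + α) := by
  induction m with
  | zero =>
    intro f hf hh p hp
    refine ⟨Polynomial.C (f p), by simp, fun t ht => ?_⟩
    have := hh t ⟨hp.1.trans ht.1, ht.2⟩ p hp
    simp only [iteratedDerivWithin_zero] at this
    rw [abs_of_nonneg (sub_nonneg.2 ht.1)] at this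
    simpa using this
  | succ m ih =>
    intro f hf hh p hp
    have hu := uniqueDiffOn_Icc hT
    have hf' : ContDiffOn ℝ m (derivWithin f (Icc 0 T)) (Icc 0 T) := by
      have := (contDiffOn_succ_iff_derivWithin (n := (m:WithTop ℕ∞)) hu).1 (by exact_mod_cast hf)
      exact this.2.2
    obtain ⟨D, hD, hD2⟩ := ih _ hf' (by simpa only [iteratedDerivWithin_succ'] using hh) p hp
    obtain ⟨P, h1, h2, h3⟩ := antideriv_step (hf.differentiableOn (by simp)) hH
      (by positivity) hp.1 D m hD hD2
    refine ⟨P, h1, fun t ht => (h3 t ht).trans (le_of_eq ?_)⟩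
    push_cast
    ring_nf

lemma poly_osc {lam : ℝ} (hl : 0 < lam) (D P : Polynomial ℝ) (hP : Polynomial.derivative P = D)
    (hD0 : D ≠ 0) (k : ℕ) :
    ∀ p q : ℝ, p ≤ q → (D.roots.toFinset.filter (fun r => r ∈ Ioo p q)).card ≤ k →
    ∫ t in p..q, |D.eval t| * (1 + (P.eval t / lam) ^ 2)⁻¹ ≤ (k + 1) * (4 * lam) := by
  have hc : Continuous fun t => |D.eval t| * (1 + (P.eval t / lam) ^ 2)⁻¹ := by
    refine (Polynomial.continuous D).abs.mul (Continuous.inv₀ ?_ fun t => by positivity)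
    exact continuous_const.add (((Polynomial.continuous P).div_const _).pow 2)
  have hd : ∀ t, HasDerivAt (fun t => lam * Real.arctan (P.eval t / lam))
      (D.eval t * (1 + (P.eval t / lam) ^ 2)⁻¹) t := by
    intro t
    have h := ((((P.hasDerivAt t).div_const lam).arctan).const_mul lam)
    rw [hP] at h
    refine h.congr_deriv ?_
    field_simp
  have hc' : Continuous fun t => D.eval t * (1 + (P.eval t / lam) ^ 2)⁻¹ := by
    refine (Polynomial.continuous D).mul (Continuous.inv₀ ?_ fun t => by positivity)
    exact continuous_const.add (((Polynomial.continuous P).div_const _).pow 2)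
  have hbd : ∀ p q : ℝ, |∫ t in p..q, D.eval t * (1 + (P.eval t / lam) ^ 2)⁻¹| ≤ 4 * lam := by
    intro p q
    rw [intervalIntegral.integral_eq_sub_of_hasDerivAt (fun t _ => hd t)
      (hc'.intervalIntegrable _ _), ← mul_sub, abs_mul, abs_of_pos hl, mul_comm]
    have a1 := Real.arctan_lt_pi_div_two (P.eval p / lam)
    have a2 := Real.arctan_lt_pi_div_two (P.eval q / lam)
    have a3 := Real.neg_pi_div_two_lt_arctan (P.eval p / lam)
    have a4 := Real.neg_pi_div_two_lt_arctan (P.eval q / lam)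
    have a5 := Real.pi_lt_four
    refine mul_le_mul_of_nonneg_right ?_ hl.le
    rw [abs_le]; constructor <;> linarith
  -- no interior root
  have base : ∀ p q : ℝ, p ≤ q → (∀ r ∈ Ioo p q, D.eval r ≠ 0) →
      ∫ t in p..q, |D.eval t| * (1 + (P.eval t / lam) ^ 2)⁻¹ ≤ 4 * lam := by
    intro p q hpq hr
    have hsign : (∀ t ∈ Ioo p q, 0 ≤ D.eval t) ∨ (∀ t ∈ Ioo p q, D.eval t ≤ 0) := by
      by_contra hcon
      push Not at hcon
      obtain ⟨⟨s, hs, hs'⟩, ⟨t, ht, ht'⟩⟩ := hcon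
      have := isPreconnected_Ioo.intermediate_value hs ht
        (Polynomial.continuous D).continuousOn ⟨hs'.le, ht'.le⟩
      obtain ⟨r, hr1, hr2⟩ := this
      exact hr r hr1 hr2
    rcases hsign with h | h
    · have e : ∫ t in p..q, |D.eval t| * (1 + (P.eval t / lam) ^ 2)⁻¹ =
          ∫ t in p..q, D.eval t * (1 + (P.eval t / lam) ^ 2)⁻¹ := by
        rw [intervalIntegral.integral_of_le hpq, intervalIntegral.integral_of_le hpq,
          MeasureTheory.integral_Ioc_eq_integral_Ioo, MeasureTheory.integral_Ioc_eq_integral_Ioo]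
        refine MeasureTheory.setIntegral_congr_fun measurableSet_Ioo fun t ht => ?_
        simp only [abs_of_nonneg (h t ht)]
      rw [e]; exact (le_abs_self _).trans (hbd p q)
    · have e : ∫ t in p..q, |D.eval t| * (1 + (P.eval t / lam) ^ 2)⁻¹ =
          -∫ t in p..q, D.eval t * (1 + (P.eval t / lam) ^ 2)⁻¹ := by
        rw [← intervalIntegral.integral_neg,
          intervalIntegral.integral_of_le hpq, intervalIntegral.integral_of_le hpq,
          MeasureTheory.integral_Ioc_eq_integral_Ioo, MeasureTheory.integral_Ioc_eq_integral_Ioo]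
        refine MeasureTheory.setIntegral_congr_fun measurableSet_Ioo fun t ht => ?_
        simp only [abs_of_nonpos (h t ht)]; ring
      rw [e]; exact (neg_le_abs _).trans (hbd p q)
  induction k using Nat.strong_induction_on with
  | _ k ih =>
    intro p q hpq hcard
    by_cases hr : ∀ r ∈ Ioo p q, D.eval r ≠ 0
    · refine (base p q hpq hr).trans ?_
      have : (0:ℝ) ≤ k := Nat.cast_nonneg k
      nlinarith
    · push Not at hr
      obtain ⟨r, hr, hr0⟩ := hr
      set S := D.roots.toFinset with hS
      have hrS : r ∈ S := by
        rw [hS, Multiset.mem_toFinset, Polynomial.mem_roots hD0]; exact hr0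
      set k1 := (S.filter (fun s => s ∈ Ioo p r)).card with hk1
      set k2 := (S.filter (fun s => s ∈ Ioo r q)).card with hk2
      have hdis : Disjoint (S.filter (fun s => s ∈ Ioo p r)) (S.filter (fun s => s ∈ Ioo r q)) := by
        rw [Finset.disjoint_left]
        intro s h1 h2
        have h1 := (Finset.mem_filter.1 h1).2
        have h2 := (Finset.mem_filter.1 h2).2
        exact absurd h1.2 (not_lt.2 h2.1.le)
      have hlt : k1 + k2 < (S.filter (fun s => s ∈ Ioo p q)).card := by
        rw [hk1, hk2, ← Finset.card_union_of_disjoint hdis]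
        apply Finset.card_lt_card
        rw [Finset.ssubset_iff_of_subset]
        · refine ⟨r, Finset.mem_filter.2 ⟨hrS, hr⟩, ?_⟩
          simp
        · intro s hs
          rcases Finset.mem_union.1 hs with hs | hs
          · have := Finset.mem_filter.1 hs
            exact Finset.mem_filter.2 ⟨this.1, this.2.1, this.2.2.trans hr.2⟩
          · have := Finset.mem_filter.1 hs
            exact Finset.mem_filter.2 ⟨this.1, hr.1.trans this.2.1, this.2.2⟩
      have i1 := ih k1 (by omega) p r hr.1.le le_rfl
      have i2 := ih k2 (by omega) r q hr.2.le le_rfl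
      rw [← intervalIntegral.integral_add_adjacent_intervals (hc.intervalIntegrable p r)
        (hc.intervalIntegrable r q)]
      have : (k1:ℝ) + k2 + 1 ≤ k := by
        have : k1 + k2 + 1 ≤ k := by omega
        exact_mod_cast this
      nlinarith

lemma poly_osc' {lam : ℝ} (hl : 0 < lam) (D P : Polynomial ℝ) (hP : Polynomial.derivative P = D)
    (m : ℕ) (hm : D.natDegree ≤ m) (p q : ℝ) (hpq : p ≤ q) :
    ∫ t in p..q, |D.eval t| * (1 + (P.eval t / lam) ^ 2)⁻¹ ≤ (m + 1) * (4 * lam) := by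
  by_cases hD0 : D = 0
  · simp [hD0]; positivity
  · refine poly_osc hl D P hP hD0 m p q hpq ?_
    refine (Finset.card_filter_le _ _).trans ((Multiset.toFinset_card_le _).trans ?_)
    exact (Polynomial.card_roots' D).trans hm

end Osc

section Main1

lemma kernel_compare {M x y lam : ℝ} (hl : 0 < lam) (h : |x - y| ≤ M * lam) :
    (1 + (x / lam) ^ 2)⁻¹ ≤ (2 + 2 * M ^ 2) * (1 + (y / lam) ^ 2)⁻¹ := by
  have e : x / lam - y / lam = (x - y) / lam := by ring
  have h1 : |x / lam - y / lam| ≤ M := by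
    rw [e, abs_div, abs_of_pos hl, div_le_iff₀ hl]; exact h
  set u := x / lam
  set v := y / lam
  have h2 : (u - v) ^ 2 ≤ M ^ 2 := by
    have := abs_nonneg (u - v)
    rw [← sq_abs]; exact pow_le_pow_left₀ this h1 2
  have h3 : 1 + v ^ 2 ≤ (2 + 2 * M ^ 2) * (1 + u ^ 2) := by
    nlinarith [sq_nonneg (u - (v - u)), sq_nonneg (M * u), sq_nonneg u]
  rw [← div_eq_mul_inv, inv_eq_one_div, div_le_div_iff₀ (by positivity) (by positivity)]
  linarith

lemma piece_bound {T : ℝ} {b : ℝ → ℝ} (hbc : ContinuousOn b (Icc 0 T))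
    (hdc : ContinuousOn (derivWithin b (Icc 0 T)) (Icc 0 T)) {H lam h : ℝ} (hH : 0 ≤ H)
    (hl : 0 < lam) (hh : 0 < h) {p q : ℝ} (hp : 0 ≤ p) (hq : q ≤ T) (hpq : p ≤ q)
    (hlen : q - p ≤ h) (D P : Polynomial ℝ) (m : ℕ) (hm : D.natDegree ≤ m)
    (hP : Polynomial.derivative P = D)
    (h1 : ∀ t ∈ Icc p q, |derivWithin b (Icc 0 T) t - D.eval t| ≤ H * (lam / h))
    (h2 : ∀ t ∈ Icc p q, |b t - P.eval t| ≤ H * lam) :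
    ∫ t in p..q, |derivWithin b (Icc 0 T) t| * (1 + (b t / lam) ^ 2)⁻¹ ≤
      ((2 + 2 * H ^ 2) * ((m + 1) * 4 + H)) * lam := by
  have hsub : Icc p q ⊆ Icc 0 T := Icc_subset_Icc hp hq
  have hc : Continuous fun t => |D.eval t| * (1 + (P.eval t / lam) ^ 2)⁻¹ := by
    refine (Polynomial.continuous D).abs.mul (Continuous.inv₀ ?_ fun t => by positivity)
    exact continuous_const.add (((Polynomial.continuous P).div_const _).pow 2)
  have hci : ContinuousOn (fun t => |derivWithin b (Icc 0 T) t| * (1 + (b t / lam) ^ 2)⁻¹)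
      (Icc p q) := by
    refine (hdc.mono hsub).abs.mul (ContinuousOn.inv₀ ?_ fun t _ => by positivity)
    exact continuousOn_const.add (((hbc.mono hsub).div_const _).pow 2)
  have hpt : ∀ t ∈ Icc p q, |derivWithin b (Icc 0 T) t| * (1 + (b t / lam) ^ 2)⁻¹ ≤
      (2 + 2 * H ^ 2) * (|D.eval t| * (1 + (P.eval t / lam) ^ 2)⁻¹ + H * (lam / h)) := by
    intro t ht
    have e1 : |derivWithin b (Icc 0 T) t| ≤ |D.eval t| + H * (lam / h) := by
      have := h1 t ht
      have := abs_sub_abs_le_abs_sub (derivWithin b (Icc 0 T) t) (D.eval t)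
      linarith
    have e2 := kernel_compare hl (h2 t ht)
    have e3 : (1 + (P.eval t / lam) ^ 2)⁻¹ ≤ 1 := by
      apply inv_le_one_of_one_le₀; nlinarith [sq_nonneg (P.eval t / lam)]
    have e4 : 0 ≤ (1 + (P.eval t / lam) ^ 2)⁻¹ := by positivity
    have e5 : 0 ≤ H * (lam / h) := by positivity
    calc _ ≤ (|D.eval t| + H * (lam / h)) * ((2 + 2 * H ^ 2) * (1 + (P.eval t / lam) ^ 2)⁻¹) :=
          mul_le_mul e1 e2 (by positivity) (by positivity)
      _ = (2 + 2 * H ^ 2) * (|D.eval t| * (1 + (P.eval t / lam) ^ 2)⁻¹ +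
            H * (lam / h) * (1 + (P.eval t / lam) ^ 2)⁻¹) := by ring
      _ ≤ _ := by
          refine mul_le_mul_of_nonneg_left ?_ (by positivity)
          have := mul_le_mul_of_nonneg_left e3 e5
          linarith
  have hint : IntervalIntegrable (fun t => |derivWithin b (Icc 0 T) t| * (1 + (b t / lam) ^ 2)⁻¹)
      MeasureTheory.volume p q := by
    apply ContinuousOn.intervalIntegrable; rwa [uIcc_of_le hpq]
  refine (intervalIntegral.integral_mono_on hpq hint
    ((continuous_const.mul (hc.add continuous_const)).intervalIntegrable _ _) hpt).trans ?_
  change ∫ u in p..q, (2 + 2 * H ^ 2) * (|D.eval u| * (1 + (P.eval u / lam) ^ 2)⁻¹ +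
    H * (lam / h)) ≤ _
  rw [intervalIntegral.integral_const_mul, intervalIntegral.integral_add
    (hc.intervalIntegrable _ _) (by simp), intervalIntegral.integral_const]
  have k1 := poly_osc' hl D P hP m hm p q hpq
  have k2 : (q - p) * (H * (lam / h)) ≤ H * lam := by
    calc _ ≤ h * (H * (lam / h)) := mul_le_mul_of_nonneg_right hlen (by positivity)
      _ = H * lam := by field_simp
  rw [smul_eq_mul, mul_assoc]
  refine mul_le_mul_of_nonneg_left ?_ (by positivity)
  nlinarith

lemma osc_bound {T : ℝ} (hT : 0 < T) {n : ℕ} (hn : 1 ≤ n) {α : ℝ} (hα0 : 0 ≤ α)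
    {b : ℝ → ℝ} (hb : CnAlpha n α T b) :
    ∃ C : ℝ, 0 ≤ C ∧ ∀ lam : ℝ, 0 < lam →
      ∫ t in (0:ℝ)..T, |derivWithin b (Icc 0 T) t| * (1 + (b t / lam) ^ 2)⁻¹ ≤
        C * lam ^ (1 - 1 / ((n:ℝ) + α)) := by
  obtain ⟨hcd, H0, hH0⟩ := hb
  obtain ⟨m, rfl⟩ : ∃ m, n = m + 1 := ⟨n - 1, by omega⟩
  set H := |H0| with hHdef
  have hH : 0 ≤ H := abs_nonneg _
  have hu := uniqueDiffOn_Icc hT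
  have hsd := (contDiffOn_succ_iff_derivWithin (n := (m:WithTop ℕ∞)) hu).1 (by exact_mod_cast hcd)
  have hf' : ContDiffOn ℝ m (derivWithin b (Icc 0 T)) (Icc 0 T) := hsd.2.2
  have hbd : DifferentiableOn ℝ b (Icc 0 T) := hsd.1
  have hbc := hbd.continuousOn
  have hdc := hf'.continuousOn
  have hHol : ∀ t ∈ Icc (0:ℝ) T, ∀ t' ∈ Icc (0:ℝ) T,
      |iteratedDerivWithin m (derivWithin b (Icc 0 T)) (Icc 0 T) t -
        iteratedDerivWithin m (derivWithin b (Icc 0 T)) (Icc 0 T) t'| ≤ H * |t - t'| ^ α := by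
    intro t ht t' ht'
    have := hH0 t ht t' ht'
    rw [iteratedDerivWithin_succ'] at this
    refine this.trans (mul_le_mul_of_nonneg_right (le_abs_self _) (by positivity))
  set c : ℝ := (2 + 2 * H ^ 2) * ((m + 1) * 4 + H) with hc
  have hc0 : 0 ≤ c := by positivity
  set V : ℝ := ∫ t in (0:ℝ)..T, |derivWithin b (Icc 0 T) t| with hV
  have hV0 : 0 ≤ V := intervalIntegral.integral_nonneg hT.le fun t _ => abs_nonneg _
  have hci : ∀ lam : ℝ, 0 < lam →
      ContinuousOn (fun t => |derivWithin b (Icc 0 T) t| * (1 + (b t / lam) ^ 2)⁻¹) (Icc 0 T) := by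
    intro lam hl
    refine hdc.abs.mul (ContinuousOn.inv₀ ?_ fun t _ => by positivity)
    exact continuousOn_const.add ((hbc.div_const _).pow 2)
  have hna : (1:ℝ) ≤ ((m+1 : ℕ) : ℝ) + α := by
    push_cast; have : (0:ℝ) ≤ m := Nat.cast_nonneg m
    linarith
  set ν : ℝ := ((m+1 : ℕ) : ℝ) + α with hν
  refine ⟨V + (T + 1) * c, by positivity, fun lam hl => ?_⟩
  have hrp : 0 ≤ lam ^ (1 - 1 / ν) := by positivity
  rcases le_total 1 lam with h1 | h1
  · have e1 : ∫ t in (0:ℝ)..T, |derivWithin b (Icc 0 T) t| * (1 + (b t / lam) ^ 2)⁻¹ ≤ V := by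
      refine intervalIntegral.integral_mono_on hT.le ?_ ?_ ?_
      · apply ContinuousOn.intervalIntegrable; rw [uIcc_of_le hT.le]; exact hci lam hl
      · apply ContinuousOn.intervalIntegrable; rw [uIcc_of_le hT.le]; exact hdc.abs
      · intro t _
        refine mul_le_of_le_one_right (abs_nonneg _) ?_
        apply inv_le_one_of_one_le₀; nlinarith [sq_nonneg (b t / lam)]
    have e2 : 1 ≤ lam ^ (1 - 1 / ν) := by
      apply Real.one_le_rpow h1
      rw [sub_nonneg, div_le_one (by linarith)]; exact hna
    have : 0 ≤ (T + 1) * c := by positivity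
    nlinarith
  · set h := lam ^ (1 / ν) with hh
    have hh0 : 0 < h := by positivity
    have hh1 : h ≤ 1 := Real.rpow_le_one hl.le h1 (by positivity)
    have hν0 : ν ≠ 0 := by linarith
    have hhν : h ^ ν = lam := by
      rw [hh, ← Real.rpow_mul hl.le, one_div, inv_mul_cancel₀ hν0, Real.rpow_one]
    have hhν' : h ^ ((m:ℝ) + α) = lam / h := by
      rw [← hhν, ← Real.rpow_sub_one hh0.ne']; congr 1; rw [hν]; push_cast; ring
    set N := ⌈T / h⌉₊ with hN
    have hN0 : 0 < N := Nat.ceil_pos.2 (by positivity)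
    have hN0' : (0:ℝ) < N := by exact_mod_cast hN0
    have hN1 : T / h ≤ N := Nat.le_ceil _
    have hN2 : (N:ℝ) ≤ (T + 1) / h := by
      have := (Nat.ceil_lt_add_one (a := T / h) (by positivity)).le
      refine this.trans ?_
      rw [add_div]
      have : 1 ≤ 1 / h := by rw [le_div_iff₀ hh0]; linarith
      linarith
    have hstep : T / N ≤ h := by
      rw [div_le_iff₀ hN0']; rw [div_le_iff₀ hh0] at hN1; linarith
    have hsum := intervalIntegral.sum_integral_adjacent_intervals (μ := MeasureTheory.volume)
      (f := fun t => |derivWithin b (Icc 0 T) t| * (1 + (b t / lam) ^ 2)⁻¹)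
      (a := fun k : ℕ => (k:ℝ) * (T / N)) (n := N) ?_
    · have eT : (N:ℝ) * (T / N) = T := by field_simp
      simp only [Nat.cast_zero, zero_mul, eT] at hsum
      rw [← hsum]
      have hle : ∀ k ∈ Finset.range N,
          ∫ t in ((k:ℝ) * (T / N))..(((k+1:ℕ):ℝ) * (T / N)),
            |derivWithin b (Icc 0 T) t| * (1 + (b t / lam) ^ 2)⁻¹ ≤ c * lam := by
        intro k hk
        have hkN : ((k+1:ℕ):ℝ) ≤ N := by exact_mod_cast Finset.mem_range.1 hk
        have hTN : 0 < T / N := by positivity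
        have p0 : 0 ≤ (k:ℝ) * (T / N) := by positivity
        have q0 : ((k+1:ℕ):ℝ) * (T / N) ≤ T := by
          calc _ ≤ (N:ℝ) * (T / N) := mul_le_mul_of_nonneg_right hkN hTN.le
            _ = T := eT
        have pq : (k:ℝ) * (T / N) ≤ ((k+1:ℕ):ℝ) * (T / N) := by push_cast; nlinarith
        have len : ((k+1:ℕ):ℝ) * (T / N) - (k:ℝ) * (T / N) ≤ h := by push_cast; linarith
        generalize (k:ℝ) * (T / N) = p at *
        generalize ((k+1:ℕ):ℝ) * (T / N) = q at *
        obtain ⟨D, hD, hD2⟩ := poly_approx hT hH hα0 m _ hf' hHol p ⟨p0, pq.trans q0⟩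
        obtain ⟨P, g1, g2, g3⟩ := antideriv_step hbd hH (by positivity) p0 D m hD hD2
        refine piece_bound hbc hdc hH hl hh0 p0 q0 pq len D P m hD g2 ?_ ?_
        · intro t ht
          refine (hD2 t ⟨ht.1, ht.2.trans q0⟩).trans (mul_le_mul_of_nonneg_left ?_ hH)
          rw [← hhν']
          exact Real.rpow_le_rpow (sub_nonneg.2 ht.1) (by linarith [ht.2]) (by positivity)
        · intro t ht
          refine (g3 t ⟨ht.1, ht.2.trans q0⟩).trans (mul_le_mul_of_nonneg_left ?_ hH)
          rw [show (m:ℝ) + α + 1 = ν by rw [hν]; push_cast; ring, ← hhν]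
          exact Real.rpow_le_rpow (sub_nonneg.2 ht.1) (by linarith [ht.2]) (by positivity)
      refine (Finset.sum_le_sum hle).trans ?_
      rw [Finset.sum_const, Finset.card_range, nsmul_eq_mul]
      have e : lam ^ (1 - 1 / ν) = lam / h := by
        rw [Real.rpow_sub hl, Real.rpow_one]
      rw [e]
      have : 0 ≤ V * (lam / h) := by positivity
      calc (N:ℝ) * (c * lam) ≤ (T + 1) / h * (c * lam) :=
            mul_le_mul_of_nonneg_right hN2 (by positivity)
        _ = (T + 1) * c * (lam / h) := by ring
        _ ≤ _ := by linarith
    · intro k hk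
      apply ContinuousOn.intervalIntegrable
      refine (hci lam hl).mono ?_
      have hTN : 0 < T / N := by positivity
      have hkN : ((k+1:ℕ):ℝ) ≤ N := by exact_mod_cast hk
      rw [uIcc_of_le (by push_cast; nlinarith)]
      refine Icc_subset_Icc (by positivity) ?_
      calc _ ≤ (N:ℝ) * (T / N) := mul_le_mul_of_nonneg_right hkN hTN.le
        _ = T := by field_simp

lemma dyadic_pointwise {y ψ : ℝ} (hy : 0 ≤ y) (hψ : 0 < ψ) (M : ℕ) (hM : y ≤ 2 ^ M * ψ) :
    (y + ψ)⁻¹ ≤ ∑ k ∈ Finset.range (M + 1),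
      4 / (2 ^ k * ψ) * (1 + (y / (2 ^ k * ψ)) ^ 2)⁻¹ := by
  classical
  have hex : ∃ k : ℕ, y ≤ 2 ^ k * ψ := ⟨M, hM⟩
  set k := Nat.find hex with hk
  have hk1 : y ≤ 2 ^ k * ψ := Nat.find_spec hex
  have hkM : k ≤ M := Nat.find_min' hex hM
  have hpos : 0 < 2 ^ k * ψ := by positivity
  have hlow : 2 ^ k * ψ ≤ 2 * (y + ψ) := by
    rcases Nat.eq_zero_or_pos k with h0 | h0
    · rw [h0]; simp; linarith
    · have := Nat.find_min hex (m := k - 1) (by omega)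
      push Not at this
      have e : (2:ℝ) ^ k = 2 * 2 ^ (k-1) := by
        rw [← pow_succ']; congr 1; omega
      rw [e]; nlinarith
  refine le_trans ?_ (Finset.single_le_sum (f := fun k => 4 / (2 ^ k * ψ) *
    (1 + (y / (2 ^ k * ψ)) ^ 2)⁻¹) (fun i _ => by positivity)
    (Finset.mem_range.2 (Nat.lt_succ_of_le hkM)))
  have h1 : y / (2 ^ k * ψ) ≤ 1 := (div_le_one hpos).2 hk1
  have h0 : 0 ≤ y / (2 ^ k * ψ) := by positivity
  have h2 : 1 + (y / (2 ^ k * ψ)) ^ 2 ≤ 2 := by nlinarith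
  have h3 : (2:ℝ)⁻¹ ≤ (1 + (y / (2 ^ k * ψ)) ^ 2)⁻¹ := inv_anti₀ (by positivity) h2
  calc (y + ψ)⁻¹ ≤ (2 ^ k * ψ / 2)⁻¹ := inv_anti₀ (by positivity) (by linarith)
    _ = 4 / (2 ^ k * ψ) * 2⁻¹ := by rw [inv_div]; field_simp; norm_num
    _ ≤ _ := mul_le_mul_of_nonneg_left h3 (by positivity)

lemma log_osc_bound {T : ℝ} (hT : 0 < T) {n : ℕ} (hn : 1 ≤ n) {α : ℝ} (hα0 : 0 ≤ α)
    {b : ℝ → ℝ} (hb : CnAlpha n α T b) (hb0 : ∀ t ∈ Icc (0:ℝ) T, 0 ≤ b t)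
    (hdc : ContinuousOn (derivWithin b (Icc 0 T)) (Icc 0 T)) :
    ∃ C : ℝ, 0 ≤ C ∧ ∀ ψ : ℝ, 0 < ψ →
      ∫ t in (0:ℝ)..T, |derivWithin b (Icc 0 T) t| * (b t + ψ)⁻¹ ≤
        C * ψ ^ (-(1 / ((n:ℝ) + α))) := by
  obtain ⟨C, hC, hosc⟩ := osc_bound hT hn hα0 hb
  have hbc : ContinuousOn b (Icc 0 T) := hb.1.continuousOn
  have hn' : (1:ℝ) ≤ n := by exact_mod_cast hn
  set κ : ℝ := 1 / ((n:ℝ) + α) with hκ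
  have hκ0 : 0 < κ := by positivity
  set ρ : ℝ := (2:ℝ) ^ (-κ) with hρ
  have hρ0 : 0 ≤ ρ := by positivity
  have hρ1 : ρ < 1 := Real.rpow_lt_one_of_one_lt_of_neg (by norm_num) (by linarith)
  obtain ⟨K, hK⟩ := isCompact_Icc.exists_bound_of_continuousOn hbc
  refine ⟨4 * C * (1 - ρ)⁻¹, by have : 0 < 1 - ρ := by linarith
                                positivity, fun ψ hψ => ?_⟩
  obtain ⟨M, hM⟩ : ∃ M : ℕ, K / ψ ≤ 2 ^ M := by
    obtain ⟨M, hM⟩ := pow_unbounded_of_one_lt (K / ψ) (one_lt_two)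
    exact ⟨M, hM.le⟩
  have hKM : ∀ t ∈ Icc (0:ℝ) T, b t ≤ 2 ^ M * ψ := fun t ht =>
    ((le_abs_self _).trans (hK t ht)).trans ((div_le_iff₀ hψ).1 hM)
  have hci : ∀ lam : ℝ, 0 < lam →
      ContinuousOn (fun t => |derivWithin b (Icc 0 T) t| * (1 + (b t / lam) ^ 2)⁻¹) (Icc 0 T) := by
    intro lam hl
    refine hdc.abs.mul (ContinuousOn.inv₀ ?_ fun t _ => by positivity)
    exact continuousOn_const.add ((hbc.div_const _).pow 2)
  have hi : ∀ lam : ℝ, 0 < lam → IntervalIntegrable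
      (fun t => |derivWithin b (Icc 0 T) t| * (1 + (b t / lam) ^ 2)⁻¹)
        MeasureTheory.volume 0 T := by
    intro lam hl
    apply ContinuousOn.intervalIntegrable; rw [uIcc_of_le hT.le]; exact hci lam hl
  have step1 : ∫ t in (0:ℝ)..T, |derivWithin b (Icc 0 T) t| * (b t + ψ)⁻¹ ≤
      ∫ t in (0:ℝ)..T, ∑ k ∈ Finset.range (M+1), 4 / (2 ^ k * ψ) *
        (|derivWithin b (Icc 0 T) t| * (1 + (b t / (2 ^ k * ψ)) ^ 2)⁻¹) := by
    refine intervalIntegral.integral_mono_on hT.le ?_ ?_ ?_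
    · apply ContinuousOn.intervalIntegrable; rw [uIcc_of_le hT.le]
      exact hdc.abs.mul ((hbc.add continuousOn_const).inv₀
        fun t ht => (add_pos_of_nonneg_of_pos (hb0 t ht) hψ).ne')
    · apply ContinuousOn.intervalIntegrable; rw [uIcc_of_le hT.le]
      exact continuousOn_finsetSum _ fun k _ => continuousOn_const.mul (hci _ (by positivity))
    · intro t ht
      have := mul_le_mul_of_nonneg_left (dyadic_pointwise (hb0 t ht) hψ M (hKM t ht))
        (abs_nonneg (derivWithin b (Icc 0 T) t))
      refine this.trans (le_of_eq ?_)
      rw [Finset.mul_sum]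
      exact Finset.sum_congr rfl fun k _ => by ring
  refine step1.trans ?_
  rw [intervalIntegral.integral_finsetSum
    (fun k _ => (hi _ (by positivity)).const_mul _)]
  have hterm : ∀ k ∈ Finset.range (M+1),
      ∫ t in (0:ℝ)..T, 4 / (2 ^ k * ψ) *
        (|derivWithin b (Icc 0 T) t| * (1 + (b t / (2 ^ k * ψ)) ^ 2)⁻¹) ≤
      4 * C * ψ ^ (-κ) * ρ ^ k := by
    intro k _
    have hpos : 0 < 2 ^ k * ψ := by positivity
    rw [intervalIntegral.integral_const_mul]
    refine (mul_le_mul_of_nonneg_left (hosc _ hpos) (by positivity)).trans (le_of_eq ?_)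
    have e1 : (2 ^ k * ψ) ^ (1 - κ) = (2 ^ k * ψ) * (ψ ^ (-κ) * ρ ^ k) := by
      rw [sub_eq_add_neg, Real.rpow_add hpos, Real.rpow_one,
        Real.mul_rpow (by positivity) hψ.le, hρ, ← Real.rpow_natCast, ← Real.rpow_natCast,
        ← Real.rpow_mul (by norm_num), ← Real.rpow_mul (by norm_num)]
      ring_nf
    rw [e1]; field_simp
  refine (Finset.sum_le_sum hterm).trans ?_
  rw [← Finset.mul_sum]
  have hgeo : ∑ k ∈ Finset.range (M+1), ρ ^ k ≤ (1 - ρ)⁻¹ := by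
    rw [← tsum_geometric_of_lt_one hρ0 hρ1]
    exact (summable_geometric_of_lt_one hρ0 hρ1).sum_le_tsum _ (fun k _ => by positivity)
  calc _ ≤ 4 * C * ψ ^ (-κ) * (1 - ρ)⁻¹ := mul_le_mul_of_nonneg_left hgeo (by positivity)
    _ = _ := by ring

end Main1

section Theta

/-- derivatives in `y` of `∫ |b'|/(b+y)` -/
noncomputable def Theta (b : ℝ → ℝ) (T : ℝ) (k : ℕ) (t y : ℝ) : ℝ :=
  (-1) ^ k * (k.factorial : ℝ) *
    ∫ σ in (0:ℝ)..t, |derivWithin b (Icc 0 T) σ| * ((b σ + y)⁻¹) ^ (k+1)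

variable {T : ℝ} {b : ℝ → ℝ}

lemma theta_cont (hbc : ContinuousOn b (Icc 0 T)) (hb0 : ∀ t ∈ Icc (0:ℝ) T, 0 ≤ b t)
    (hdc : ContinuousOn (derivWithin b (Icc 0 T)) (Icc 0 T)) (k : ℕ) {y : ℝ} (hy : 0 < y) :
    ContinuousOn (fun σ => |derivWithin b (Icc 0 T) σ| * ((b σ + y)⁻¹) ^ k) (Icc 0 T) :=
  hdc.abs.mul (((hbc.add continuousOn_const).inv₀
        fun t ht => (add_pos_of_nonneg_of_pos (hb0 t ht) hy).ne').pow k)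

lemma theta_int (hbc : ContinuousOn b (Icc 0 T)) (hb0 : ∀ t ∈ Icc (0:ℝ) T, 0 ≤ b t)
    (hdc : ContinuousOn (derivWithin b (Icc 0 T)) (Icc 0 T)) (k : ℕ) {y : ℝ} (hy : 0 < y)
    {s t : ℝ} (hs : s ∈ Icc (0:ℝ) T) (ht : t ∈ Icc (0:ℝ) T) :
    IntervalIntegrable (fun σ => |derivWithin b (Icc 0 T) σ| * ((b σ + y)⁻¹) ^ k)
      MeasureTheory.volume s t := by
  apply ContinuousOn.intervalIntegrable
  exact (theta_cont hbc hb0 hdc k hy).mono (uIcc_subset_Icc hs ht)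

lemma theta_deriv (hbc : ContinuousOn b (Icc 0 T)) (hb0 : ∀ t ∈ Icc (0:ℝ) T, 0 ≤ b t)
    (hdc : ContinuousOn (derivWithin b (Icc 0 T)) (Icc 0 T)) (k : ℕ) {t : ℝ}
    (ht : t ∈ Icc (0:ℝ) T) {y : ℝ} (hy : 0 < y) :
    HasDerivAt (Theta b T k t) (Theta b T (k+1) t y) y := by
  have h0 : (0:ℝ) ∈ Icc (0:ℝ) T := ⟨le_rfl, ht.1.trans ht.2⟩
  have hsub : ∀ σ ∈ uIoc 0 t, σ ∈ Icc (0:ℝ) T := fun σ hσ =>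
    uIcc_subset_Icc h0 ht (uIoc_subset_uIcc hσ)
  have key := intervalIntegral.hasDerivAt_integral_of_dominated_loc_of_deriv_le
    (μ := MeasureTheory.volume) (a := 0) (b := t)
    (F := fun y σ => |derivWithin b (Icc 0 T) σ| * ((b σ + y)⁻¹) ^ (k+1))
    (F' := fun y σ => -((k:ℝ)+1) * (|derivWithin b (Icc 0 T) σ| * ((b σ + y)⁻¹) ^ (k+2)))
    (x₀ := y) (s := Ioi (y/2))
    (bound := fun σ => ((k:ℝ)+1) * (|derivWithin b (Icc 0 T) σ| * ((b σ + y/2)⁻¹) ^ (k+2)))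
    (Ioi_mem_nhds (by linarith)) ?_ (theta_int hbc hb0 hdc _ hy h0 ht)
    (((theta_int hbc hb0 hdc _ hy h0 ht).const_mul _).def'.aestronglyMeasurable) ?_
    ((theta_int hbc hb0 hdc _ (by linarith) h0 ht).const_mul _) ?_
  · have h := key.2.const_mul ((-1 : ℝ) ^ k * (k.factorial : ℝ))
    unfold Theta
    refine h.congr_deriv ?_
    rw [intervalIntegral.integral_const_mul, Nat.factorial_succ, pow_succ]
    push_cast
    ring
  · filter_upwards [Ioi_mem_nhds hy] with z hz
    exact (theta_int hbc hb0 hdc _ hz h0 ht).def'.aestronglyMeasurable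
  · refine Filter.Eventually.of_forall fun σ hσ z hz => ?_
    have hbσ := hb0 σ (hsub σ hσ)
    have hz' : y / 2 < z := hz
    have e1 : 0 < b σ + y / 2 := by linarith
    have e2 : 0 < b σ + z := by linarith
    rw [Real.norm_eq_abs, abs_mul, abs_neg, abs_of_nonneg (by positivity : (0:ℝ) ≤ (k:ℝ)+1),
      abs_of_nonneg (by positivity)]
    gcongr
  · refine Filter.Eventually.of_forall fun σ hσ z hz => ?_
    have hbσ := hb0 σ (hsub σ hσ)
    have hz' : y / 2 < z := hz
    have e2 : 0 < b σ + z := by linarith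
    have h := ((((hasDerivAt_id z).const_add (b σ)).inv e2.ne').pow (k+1)).const_mul
      (|derivWithin b (Icc 0 T) σ|)
    refine h.congr_deriv ?_
    simp only [id, Pi.inv_apply, Nat.add_sub_cancel]
    push_cast
    rw [pow_add _ k 2]
    field_simp

lemma theta_bound (hT : 0 < T) (hbc : ContinuousOn b (Icc 0 T))
    (hb0 : ∀ t ∈ Icc (0:ℝ) T, 0 ≤ b t)
    (hdc : ContinuousOn (derivWithin b (Icc 0 T)) (Icc 0 T)) (k : ℕ) {t : ℝ}
    (ht : t ∈ Icc (0:ℝ) T) {y : ℝ} (hy : 0 < y) :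
    |Theta b T k t y| ≤ (k.factorial : ℝ) * (y⁻¹) ^ k *
      ∫ σ in (0:ℝ)..T, |derivWithin b (Icc 0 T) σ| * (b σ + y)⁻¹ := by
  have h0 : (0:ℝ) ∈ Icc (0:ℝ) T := ⟨le_rfl, hT.le⟩
  have hT' : T ∈ Icc (0:ℝ) T := ⟨hT.le, le_rfl⟩
  have hpos : ∀ m, ∀ σ ∈ Icc (0:ℝ) T,
      0 ≤ |derivWithin b (Icc 0 T) σ| * ((b σ + y)⁻¹) ^ m := fun m σ hσ => by
    have := hb0 σ hσ
    positivity
  have i0 : 0 ≤ ∫ σ in (0:ℝ)..t, |derivWithin b (Icc 0 T) σ| * ((b σ + y)⁻¹) ^ (k+1) :=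
    intervalIntegral.integral_nonneg ht.1 fun σ hσ => hpos _ σ ⟨hσ.1, hσ.2.trans ht.2⟩
  have i1 : ∫ σ in (0:ℝ)..t, |derivWithin b (Icc 0 T) σ| * ((b σ + y)⁻¹) ^ (k+1) ≤
      ∫ σ in (0:ℝ)..T, |derivWithin b (Icc 0 T) σ| * ((b σ + y)⁻¹) ^ (k+1) := by
    rw [← intervalIntegral.integral_add_adjacent_intervals
      (theta_int hbc hb0 hdc _ hy h0 ht) (theta_int hbc hb0 hdc _ hy ht hT')]
    have := intervalIntegral.integral_nonneg (μ := MeasureTheory.volume) ht.2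
      fun σ hσ => hpos (k+1) σ ⟨ht.1.trans hσ.1, hσ.2⟩
    linarith
  have i2 : ∫ σ in (0:ℝ)..T, |derivWithin b (Icc 0 T) σ| * ((b σ + y)⁻¹) ^ (k+1) ≤
      ∫ σ in (0:ℝ)..T, (y⁻¹) ^ k * (|derivWithin b (Icc 0 T) σ| * ((b σ + y)⁻¹) ^ 1) := by
    refine intervalIntegral.integral_mono_on hT.le (theta_int hbc hb0 hdc _ hy h0 hT')
      ((theta_int hbc hb0 hdc _ hy h0 hT').const_mul _) fun σ hσ => ?_
    have hbσ := hb0 σ hσ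
    have e1 : 0 < b σ + y := by linarith
    have e2 : ((b σ + y)⁻¹) ^ k ≤ (y⁻¹) ^ k := by
      refine pow_le_pow_left₀ (by positivity) (inv_anti₀ hy (by linarith)) k
    have := mul_le_mul_of_nonneg_right e2 (hpos 1 σ hσ)
    refine le_trans (le_of_eq ?_) this
    ring
  rw [intervalIntegral.integral_const_mul] at i2
  simp only [pow_one] at i2
  rw [Theta, abs_mul, abs_mul, abs_pow, abs_neg, abs_one, one_pow, one_mul,
    abs_of_nonneg (Nat.cast_nonneg (α := ℝ) _), abs_of_nonneg i0, mul_assoc]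
  exact mul_le_mul_of_nonneg_left (i1.trans i2) (Nat.cast_nonneg _)

lemma glaeser {a : ℝ → ℝ} (ha : ContDiff ℝ 2 a) (ha0 : ∀ x, 0 ≤ a x) {M : ℝ}
    (hM : ∀ x, |iteratedDeriv 2 a x| ≤ M) (x : ℝ) : (deriv a x) ^ 2 ≤ 2 * M * a x := by
  have hd : Differentiable ℝ a := ha.differentiable (by norm_num)
  have hd2 : Differentiable ℝ (deriv a) := by
    have := ha.differentiable_iteratedDeriv 1 (by norm_num)
    rwa [iteratedDeriv_one] at this
  have hda : ∀ y, HasDerivAt a (deriv a y) y := fun y => (hd y).hasDerivAt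
  have hda2 : ∀ y, HasDerivAt (deriv a) (iteratedDeriv 2 a y) y := fun y => by
    have := (hd2 y).hasDerivAt
    rwa [iteratedDeriv_succ, iteratedDeriv_one]
  set g : ℝ → ℝ := fun y => M / 2 * (y - x) ^ 2 - a y with hg
  have hg1 : ∀ y, HasDerivAt g (M * (y - x) - deriv a y) y := fun y => by
    have h := ((((hasDerivAt_id y).sub_const x).pow 2).const_mul (M/2)).sub (hda y)
    refine h.congr_deriv ?_
    simp; ring
  have hg' : deriv g = fun y => M * (y - x) - deriv a y := funext fun y => (hg1 y).deriv
  have hg2 : ∀ y, HasDerivAt (deriv g) (M - iteratedDeriv 2 a y) y := fun y => by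
    rw [hg']
    have h := (((hasDerivAt_id y).sub_const x).const_mul M).sub (hda2 y)
    refine h.congr_deriv ?_
    simp
  have hmono : Monotone (deriv g) := by
    refine monotone_of_deriv_nonneg (fun y => (hg2 y).differentiableAt) fun y => ?_
    rw [(hg2 y).deriv]
    have := (abs_le.1 (hM y)).2
    linarith
  have hconv : ConvexOn ℝ univ g :=
    hmono.convexOn_univ_of_deriv (fun y => (hg1 y).differentiableAt)
  have htan : ∀ h : ℝ, g x + deriv g x * h ≤ g (x + h) := by
    intro h
    rcases lt_trichotomy h 0 with hh | hh | hh
    · have := hconv.slope_le_of_hasDerivAt (mem_univ (x+h)) (mem_univ x)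
        (by linarith) (hg1 x).differentiableAt.hasDerivAt
      rw [slope_def_field, div_le_iff₀ (by linarith)] at this
      nlinarith
    · simp [hh]
    · have := hconv.le_slope_of_hasDerivAt (mem_univ x) (mem_univ (x+h))
        (by linarith) (hg1 x).differentiableAt.hasDerivAt
      rw [slope_def_field, le_div_iff₀ (by linarith)] at this
      nlinarith
  have hq : ∀ h : ℝ, 0 ≤ M / 2 * (h * h) + deriv a x * h + a x := by
    intro h
    have h1 := htan h
    rw [(hg1 x).deriv] at h1
    simp only [hg] at h1
    have := ha0 (x + h)
    ring_nf at h1 ⊢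
    linarith
  have := discrim_le_zero hq
  rw [discrim] at this
  linarith

end Theta

section Final

/-- parameter space `(μ,t)` -/
abbrev Par (T : ℝ) : Type := {q : ℝ × ℝ // 0 < q.1 ∧ q.1 ≤ 1 ∧ q.2 ∈ Icc (0:ℝ) T}

lemma br_sq (μ ξ : ℝ) : br μ ξ ^ 2 = μ⁻¹ ^ 2 + ξ ^ 2 := Real.sq_sqrt (by positivity)

lemma one_le_br {μ : ℝ} (h0 : 0 < μ) (h1 : μ ≤ 1) (ξ : ℝ) : 1 ≤ br μ ξ := by
  rw [br, Real.one_le_sqrt]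
  have : 1 ≤ μ⁻¹ := (one_le_inv₀ h0).2 h1
  nlinarith [sq_nonneg ξ]

lemma abs_le_br (μ ξ : ℝ) : |ξ| ≤ br μ ξ := Real.abs_le_sqrt (by nlinarith [sq_nonneg μ⁻¹])

variable {ι : Type*} {A B : ι → ℝ → ℝ → ℝ}

lemma SymC.intro {N : ℕ} {w f fx fξ : ι → ℝ → ℝ → ℝ} (h : Bd w f)
    (h1 : ∀ i x ξ, HasDerivAt (fun x' => f i x' ξ) (fx i x ξ) x)
    (h2 : ∀ i x ξ, HasDerivAt (fun ξ' => f i x ξ') (fξ i x ξ) ξ)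
    (h3 : SymC A B N (A * w) fx) (h4 : SymC A B N (B * w) fξ) : SymC A B (N+1) w f := by
  have e1 : Dx f = fx := by funext i x ξ; exact (h1 i x ξ).deriv
  have e2 : Dxi f = fξ := by funext i x ξ; exact (h2 i x ξ).deriv
  exact ⟨h, fun i x ξ => (h1 i x ξ).differentiableAt, fun i x ξ => (h2 i x ξ).differentiableAt,
    e1 ▸ h3, e2 ▸ h4⟩

/-- `r²` is a symbol -/
lemma symC_brsq (mu : ι → ℝ) (hmu : ∀ i, 0 < mu i ∧ mu i ≤ 1) (hA : ∀ i x ξ, 0 ≤ A i x ξ)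
    (hB : ∀ i x ξ, B i x ξ = (br (mu i) ξ)⁻¹) (N : ℕ) :
    SymC A B N (fun i _ ξ => (mu i)⁻¹ ^ 2 + ξ ^ 2) (fun i _ ξ => (mu i)⁻¹ ^ 2 + ξ ^ 2) := by
  have hB0 : ∀ i x ξ, 0 ≤ B i x ξ := fun i x ξ => by
    rw [hB]; exact inv_nonneg.2 (Real.sqrt_nonneg _)
  have hr : ∀ i ξ, 0 < br (mu i) ξ := fun i ξ =>
    zero_lt_one.trans_le (one_le_br (hmu i).1 (hmu i).2 ξ)
  have bd0 : Bd (fun (i : ι) (_ : ℝ) ξ => (mu i)⁻¹ ^ 2 + ξ ^ 2)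
      (fun i _ ξ => (mu i)⁻¹ ^ 2 + ξ ^ 2) :=
    ⟨1, zero_le_one, fun i x ξ => by rw [one_mul, abs_of_nonneg (by positivity)]⟩
  have bd1 : Bd (B * fun (i : ι) (_ : ℝ) ξ => (mu i)⁻¹ ^ 2 + ξ ^ 2)
      (fun _ _ ξ => 2 * ξ) := by
    refine ⟨2, zero_le_two, fun i x ξ => ?_⟩
    simp only [Pi.mul_apply, hB, ← br_sq]
    rw [abs_mul, abs_two]
    have := abs_le_br (mu i) ξ
    have e : (br (mu i) ξ)⁻¹ * br (mu i) ξ ^ 2 = br (mu i) ξ := by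
      have := (hr i ξ).ne'; field_simp
    rw [e]; linarith
  have h1 : ∀ N, SymC A B N (B * fun (i : ι) (_ : ℝ) ξ => (mu i)⁻¹ ^ 2 + ξ ^ 2)
      (fun _ _ ξ => 2 * ξ) := by
    intro N
    cases N with
    | zero => exact bd1
    | succ N =>
      refine SymC.intro bd1 (fx := fun _ _ _ => 0) (fξ := fun _ _ _ => 2)
        (fun i x ξ => hasDerivAt_const _ _) (fun i x ξ => ?_) ?_ ?_
      · simpa using (hasDerivAt_id ξ).const_mul (2:ℝ)
      · refine SymC.zero hA hB0 fun i x ξ => ?_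
        simp only [Pi.mul_apply]
        exact mul_nonneg (hA _ _ _) (mul_nonneg (hB0 _ _ _) (by positivity))
      · have e : (B * (B * fun (i : ι) (_ : ℝ) ξ => (mu i)⁻¹ ^ 2 + ξ ^ 2)) = 1 := by
          funext i x ξ
          simp only [Pi.mul_apply, hB, ← br_sq, Pi.one_apply]
          have := (hr i ξ).ne'; field_simp
        rw [e]; exact SymC.const hA hB0 2
  cases N with
  | zero => exact bd0
  | succ N =>
    refine SymC.intro bd0 (fx := fun _ _ _ => 0) (fξ := fun _ _ ξ => 2 * ξ)
      (fun i x ξ => hasDerivAt_const _ _) (fun i x ξ => ?_) ?_ (h1 N)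
    · have := ((hasDerivAt_id ξ).pow 2).const_add ((mu i)⁻¹ ^ 2)
      refine this.congr_deriv ?_
      simp
    · refine SymC.zero hA hB0 fun i x ξ => ?_
      simp only [Pi.mul_apply]
      exact mul_nonneg (hA _ _ _) (by positivity)

/-- `r^{-2δ}` is a symbol -/
lemma symC_rho (mu : ι → ℝ) (hmu : ∀ i, 0 < mu i ∧ mu i ≤ 1) (hA : ∀ i x ξ, 0 ≤ A i x ξ)
    (hB : ∀ i x ξ, B i x ξ = (br (mu i) ξ)⁻¹) (δ : ℝ) (N : ℕ) :
    SymC A B N (fun i _ ξ => br (mu i) ξ ^ (-(2*δ))) (fun i _ ξ => br (mu i) ξ ^ (-(2*δ))) := by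
  have hpos : ∀ i (x ξ : ℝ), 0 < (mu i)⁻¹ ^ 2 + ξ ^ 2 := fun i x ξ => by
    have := (hmu i).1; positivity
  have e : ∀ i ξ, br (mu i) ξ ^ (-(2*δ)) = ((mu i)⁻¹ ^ 2 + ξ ^ 2) ^ (-δ) := fun i ξ => by
    rw [← br_sq, ← Real.rpow_natCast, ← Real.rpow_mul (show 0 ≤ br (mu i) ξ from Real.sqrt_nonneg _)]
    congr 1; push_cast; ring
  have key := SymC.comp hpos (symC_brsq mu hmu hA hB)
    (fun k _ y => (∏ m ∈ Finset.range k, (-δ - (m:ℝ))) * y ^ (-δ - (k:ℝ))) ?_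
    (fun i _ ξ => ((mu i)⁻¹ ^ 2 + ξ ^ 2) ^ (-δ)) ?_ N 0
  · simp only [e]
    simpa using key
  · intro k i y hy
    have h := (Real.hasDerivAt_rpow_const (p := -δ - (k:ℝ)) (Or.inl hy.ne')).const_mul
      (∏ m ∈ Finset.range k, (-δ - (m:ℝ)))
    refine h.congr_deriv ?_
    rw [Finset.prod_range_succ]
    push_cast
    rw [show -δ - ((k:ℝ)+1) = -δ - k - 1 by ring]; ring
  · intro k
    refine ⟨|∏ m ∈ Finset.range k, (-δ - (m:ℝ))|, abs_nonneg _, fun i x ξ => ?_⟩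
    have hp := hpos i x ξ
    rw [abs_mul, abs_of_pos (Real.rpow_pos_of_pos hp _), Real.rpow_sub hp, Real.rpow_natCast,
      div_eq_mul_inv, ← inv_pow ((mu i)⁻¹ ^ 2 + ξ ^ 2) k]

lemma symC_a (hB0 : ∀ i x ξ, 0 ≤ B i x ξ) {a : ℝ → ℝ} {s : ℝ} (ha : Gevrey s a)
    (ha0 : ∀ x, 0 ≤ a x) {ph : ι → ℝ → ℝ → ℝ} (hph : ∀ i x ξ, 0 < ph i x ξ)
    (hap : ∀ i x ξ, a x ≤ ph i x ξ) {K : ℝ} (hK : ∀ i x ξ, ph i x ξ ≤ K)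
    (hA : ∀ i x ξ, A i x ξ = (Real.sqrt (ph i x ξ))⁻¹) (N : ℕ) :
    SymC A B N ph (fun _ x _ => a x) := by
  obtain ⟨hcd, C₀, A₀, hC, hA0, hg⟩ := ha
  have hApos : ∀ i x ξ, 0 < A i x ξ := fun i x ξ => by
    rw [hA]; have := hph i x ξ; positivity
  have hA2 : ∀ i x ξ, A i x ξ ^ 2 * ph i x ξ = 1 := fun i x ξ => by
    have := hph i x ξ
    rw [hA, inv_pow, Real.sq_sqrt this.le]; field_simp
  have bd : ∀ l : ℕ, Bd (A ^ l * ph) (fun _ x _ => iteratedDeriv l a x) := by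
    intro l
    match l with
    | 0 =>
      refine ⟨1, zero_le_one, fun i x ξ => ?_⟩
      simp only [iteratedDeriv_zero, pow_zero, one_mul]
      rw [abs_of_nonneg (ha0 x)]; exact hap i x ξ
    | 1 =>
      set M := C₀ * A₀ ^ 2 * ((2:ℕ).factorial : ℝ) ^ s with hM
      have hM0 : 0 ≤ M := by positivity
      refine ⟨Real.sqrt (2 * M), by positivity, fun i x ξ => ?_⟩
      have gl := glaeser (contDiff_infty.1 hcd 2) ha0 (fun x => hg x 2) x
      have e : (A ^ 1 * ph) i x ξ = Real.sqrt (ph i x ξ) := by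
        simp only [pow_one, Pi.mul_apply, hA]
        have h := hph i x ξ
        have h' := Real.sqrt_pos.2 h
        field_simp
        rw [Real.sq_sqrt h.le]
      rw [e, iteratedDeriv_one, ← Real.sqrt_mul (by positivity)]
      apply Real.abs_le_sqrt
      refine gl.trans ?_
      exact mul_le_mul_of_nonneg_left (hap i x ξ) (by positivity)
    | l+2 =>
      have hKp : ∀ i x ξ, (Real.sqrt (max K 1))⁻¹ ≤ A i x ξ := fun i x ξ => by
        rw [hA]
        have h' := Real.sqrt_pos.2 (hph i x ξ)
        exact inv_anti₀ h' (Real.sqrt_le_sqrt ((hK i x ξ).trans (le_max_left _ _)))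
      have hS : 0 < Real.sqrt (max K 1) := Real.sqrt_pos.2 (by positivity)
      set M := C₀ * A₀ ^ (l+2) * ((l+2).factorial : ℝ) ^ s with hM
      have hM0 : 0 ≤ M := by positivity
      refine ⟨M * Real.sqrt (max K 1) ^ l, by positivity, fun i x ξ => ?_⟩
      have e : (A ^ (l+2) * ph) i x ξ = A i x ξ ^ l := by
        simp only [Pi.mul_apply, Pi.pow_apply]
        rw [pow_add, mul_assoc, hA2, mul_one]
      rw [e]
      refine (hg x (l+2)).trans ?_
      have h1 := pow_le_pow_left₀ (by positivity) (hKp i x ξ) l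
      calc M = M * Real.sqrt (max K 1) ^ l * ((Real.sqrt (max K 1))⁻¹) ^ l := by
            rw [inv_pow]; field_simp
        _ ≤ _ := mul_le_mul_of_nonneg_left h1 (by positivity)
  have main : ∀ N l : ℕ, SymC A B N (A ^ l * ph) (fun _ x _ => iteratedDeriv l a x) := by
    intro N
    induction N with
    | zero => exact bd
    | succ N ih =>
      intro l
      refine SymC.intro (bd l) (fx := fun _ x _ => iteratedDeriv (l+1) a x)
        (fξ := fun _ _ _ => 0) (fun i x ξ => ?_) (fun i x ξ => hasDerivAt_const _ _) ?_ ?_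
      · have := (hcd.differentiable_iteratedDeriv l
          (by exact_mod_cast (WithTop.coe_lt_top (l:ℕ)))) x
        rw [iteratedDeriv_succ]
        exact this.hasDerivAt
      · rw [← mul_assoc, ← pow_succ']; exact ih (l+1)
      · refine SymC.zero (fun i x ξ => (hApos i x ξ).le) hB0 fun i x ξ => ?_
        simp only [Pi.mul_apply, Pi.pow_apply]
        exact mul_nonneg (hB0 _ _ _) (mul_nonneg (pow_nonneg (hApos _ _ _).le _) (hph _ _ _).le)
  have := main N 0
  simpa using this

lemma symC_inv {ph : ι → ℝ → ℝ → ℝ} (hph : ∀ i x ξ, 0 < ph i x ξ)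
    (hS : ∀ N, SymC A B N ph ph) (N : ℕ) :
    SymC A B N (fun i x ξ => (ph i x ξ)⁻¹) (fun i x ξ => (ph i x ξ)⁻¹) := by
  have key := SymC.comp hph hS
    (fun k _ y => (-1) ^ k * (k.factorial : ℝ) * (y⁻¹) ^ (k+1)) ?_
    (fun i x ξ => (ph i x ξ)⁻¹) ?_ N 0
  · simpa using key
  · intro k i y hy
    have h := ((hasDerivAt_inv hy.ne').pow (k+1)).const_mul ((-1 : ℝ) ^ k * (k.factorial : ℝ))
    refine h.congr_deriv ?_
    simp only [Nat.add_sub_cancel]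
    rw [Nat.factorial_succ]
    push_cast
    ring
  · intro k
    refine ⟨k.factorial, by positivity, fun i x ξ => ?_⟩
    have := hph i x ξ
    rw [abs_mul, abs_mul, abs_pow, abs_neg, abs_one, one_pow, one_mul, Nat.abs_cast,
      abs_of_pos (by positivity), pow_succ']

end Final
theorem stmt15 (T : ℝ) (hT : 0 < T) (n : ℕ) (hn : 1 ≤ n) (α : ℝ) (hα0 : 0 ≤ α) (hα1 : α ≤ 1)
    (b : ℝ → ℝ) (hb : CnAlpha n α T b) (hb0 : ∀ t ∈ Icc (0:ℝ) T, 0 ≤ b t)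
    (s δ : ℝ) (hs : 1 < s) (hδ0 : 0 < δ) (hδ1 : δ < 1)
    (a : ℝ → ℝ) (ha : Gevrey s a) (ha0 : ∀ x, 0 ≤ a x)
    (ε : ℝ) (hε : ε = 1 ∨ ε = -1) :
    ∀ i j k l : ℕ, ∃ C : ℝ, 0 < C ∧
      ∀ (μ t x ξ : ℝ), 0 < μ → μ ≤ 1 → t ∈ Icc (0:ℝ) T →
        |pdXiX k l (fun x' ξ' => Tij b a T δ μ ε i j t x' ξ') x ξ| ≤
          C * br μ ξ ^ ((2*δ/((n : ℝ) + α)) * ((i : ℝ) + (j : ℝ))) *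
            phi a δ μ x ξ ^ (-((j : ℝ) + (l : ℝ))/2) *
            br μ ξ ^ (-((i : ℝ) + (k : ℝ))) := by
  have hn' : (1:ℝ) ≤ n := by exact_mod_cast hn
  have hu := uniqueDiffOn_Icc hT
  have hbc : ContinuousOn b (Icc 0 T) := hb.1.continuousOn
  have hdc : ContinuousOn (derivWithin b (Icc 0 T)) (Icc 0 T) :=
    hb.1.continuousOn_derivWithin hu (by exact_mod_cast hn)
  obtain ⟨CΘ, hCΘ, hosc⟩ := log_osc_bound hT hn hα0 hb hb0 hdc
  obtain ⟨C₀, A₀, hC₀, hA₀, hgev⟩ := ha.2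
  set ν : ℝ := (n:ℝ) + α with hν
  have hν0 : 0 < ν := by positivity
  -- the families
  let mu : Par T → ℝ := fun q => q.1.1
  have hmu : ∀ q, 0 < mu q ∧ mu q ≤ 1 := fun q => ⟨q.2.1, q.2.2.1⟩
  let ph : Par T → ℝ → ℝ → ℝ := fun q x ξ => phi a δ (mu q) x ξ
  let rho : Par T → ℝ → ℝ → ℝ := fun q _ ξ => br (mu q) ξ ^ (-(2*δ))
  let A : Par T → ℝ → ℝ → ℝ := fun q x ξ => (Real.sqrt (ph q x ξ))⁻¹
  let B : Par T → ℝ → ℝ → ℝ := fun q _ ξ => (br (mu q) ξ)⁻¹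
  let R : Par T → ℝ → ℝ → ℝ := fun q _ ξ => br (mu q) ξ ^ (2*δ/ν)
  have hr1 : ∀ q ξ, 1 ≤ br (mu q) ξ := fun q ξ => one_le_br (hmu q).1 (hmu q).2 ξ
  have hr0 : ∀ q ξ, 0 < br (mu q) ξ := fun q ξ => zero_lt_one.trans_le (hr1 q ξ)
  have hrho : ∀ q x ξ, 0 < rho q x ξ := fun q x ξ => Real.rpow_pos_of_pos (hr0 q ξ) _
  have hrho1 : ∀ q x ξ, rho q x ξ ≤ 1 := fun q x ξ =>
    Real.rpow_le_one_of_one_le_of_nonpos (hr1 q ξ) (by linarith)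
  have hph_eq : ∀ q x ξ, ph q x ξ = a x + rho q x ξ := fun q x ξ => rfl
  have hph : ∀ q x ξ, 0 < ph q x ξ := fun q x ξ => by
    rw [hph_eq]; have := ha0 x; have := hrho q x ξ; linarith
  have hA : ∀ q x ξ, 0 ≤ A q x ξ := fun q x ξ => inv_nonneg.2 (Real.sqrt_nonneg _)
  have hB : ∀ q x ξ, 0 ≤ B q x ξ := fun q x ξ => inv_nonneg.2 (hr0 q ξ).le
  have hR : ∀ q x ξ, 1 ≤ R q x ξ := fun q x ξ =>
    Real.one_le_rpow (hr1 q ξ) (by positivity)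
  set K : ℝ := C₀ + 1 with hK
  have hK0 : 0 < K := by positivity
  have hphK : ∀ q x ξ, ph q x ξ ≤ K := fun q x ξ => by
    have h1 := hgev x 0
    simp only [iteratedDeriv_zero, pow_zero, mul_one, Nat.factorial_zero, Nat.cast_one,
      Real.one_rpow] at h1
    have h2 := le_abs_self (a x)
    have h3 := hrho1 q x ξ
    rw [hph_eq]; linarith
  have sRho : ∀ N, SymC A B N rho rho := fun N =>
    symC_rho mu hmu hA (fun _ _ _ => rfl) δ N
  have sA : ∀ N, SymC A B N ph (fun _ x _ => a x) := fun N =>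
    symC_a hB ha ha0 hph (fun q x ξ => by rw [hph_eq]; linarith [hrho q x ξ]) hphK
      (fun _ _ _ => rfl) N
  have sPh : ∀ N, SymC A B N ph ph := fun N =>
    SymC.add (sA N) (SymC.mono hA hB ⟨1, zero_le_one, fun q x ξ => by
      rw [hph_eq]; linarith [ha0 x]⟩ (sRho N))
  have sInv := symC_inv hph sPh
  let ps : Par T → ℝ → ℝ → ℝ := rho * fun q x ξ => (ph q x ξ)⁻¹
  have sPs : ∀ N, SymC A B N ps ps := fun N => SymC.mul (sRho N) (sInv N)
  have hps : ∀ q x ξ, 0 < ps q x ξ := fun q x ξ => mul_pos (hrho q x ξ) (inv_pos.2 (hph q x ξ))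
  have sLam0 := fun N => SymC.comp hps sPs (fun k q y => Theta b T k q.1.2 y)
    (fun k q y hy => theta_deriv hbc hb0 hdc k q.2.2.2 hy) R (by
      intro k
      refine ⟨(k.factorial : ℝ) * (CΘ * K ^ (1/ν)), by positivity, fun q x ξ => ?_⟩
      have hp := hps q x ξ
      refine (theta_bound hT hbc hb0 hdc k q.2.2.2 hp).trans ?_
      have h1 := hosc _ hp
      have h2 : rho q x ξ / K ≤ ps q x ξ :=
        mul_le_mul_of_nonneg_left (inv_anti₀ (hph q x ξ) (hphK q x ξ)) (hrho q x ξ).le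
      have h3 : ps q x ξ ^ (-(1/ν)) ≤ K ^ (1/ν) * R q x ξ := by
        have h4 : ps q x ξ ^ (-(1/ν)) ≤ (rho q x ξ / K) ^ (-(1/ν)) :=
          Real.rpow_le_rpow_of_nonpos (div_pos (hrho q x ξ) hK0) h2
            (by rw [neg_nonpos]; positivity)
        refine h4.trans (le_of_eq ?_)
        rw [Real.div_rpow (hrho q x ξ).le hK0.le, Real.rpow_neg hK0.le, div_inv_eq_mul, mul_comm]
        congr 1
        change (br (mu q) ξ ^ (-(2*δ))) ^ (-(1/ν)) = br (mu q) ξ ^ (2*δ/ν)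
        rw [← Real.rpow_mul (hr0 q ξ).le]
        congr 1; ring
      calc _ ≤ (k.factorial : ℝ) * ((ps q x ξ)⁻¹) ^ k * (CΘ * (K ^ (1/ν) * R q x ξ)) := by
            refine mul_le_mul_of_nonneg_left (h1.trans ?_) (by positivity)
            exact mul_le_mul_of_nonneg_left h3 hCΘ
        _ = _ := by ring) N 0
  let L : Par T → ℝ → ℝ → ℝ := fun q x ξ => ε * Lam b a T δ (mu q) q.1.2 x ξ
  have hLam : ∀ (q : Par T) x ξ,
      Lam b a T δ (mu q) q.1.2 x ξ = Theta b T 0 q.1.2 (ps q x ξ) := by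
    intro q x ξ
    simp only [Lam, Theta, pow_zero, Nat.factorial_zero, Nat.cast_one, one_mul, zero_add, pow_one]
    congr 1
    funext σ
    have hp : phi a δ (mu q) x ξ ≠ 0 := (hph q x ξ).ne'
    have e : b σ * phi a δ (mu q) x ξ + br (mu q) ξ ^ (-(2*δ)) =
        (b σ + ps q x ξ) * phi a δ (mu q) x ξ := by
      change _ = (b σ + br (mu q) ξ ^ (-(2*δ)) * (phi a δ (mu q) x ξ)⁻¹) * phi a δ (mu q) x ξ
      rw [add_mul, mul_assoc, inv_mul_cancel₀ hp, mul_one]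
    rw [e, mul_div_mul_right _ _ hp, div_eq_mul_inv]
  have sL : ∀ N, SymC A B N R L := by
    intro N
    have h := SymC.mul (SymC.const hA hB (N := N) ε) (sLam0 N)
    have e1 : (1 * fun (q : Par T) x ξ => R q x ξ * ((ps q x ξ)⁻¹) ^ 0) = R := by
      funext q x ξ; simp
    have e2 : ((fun (_ : Par T) (_ _ : ℝ) => ε) * fun q x ξ => Theta b T 0 q.1.2 (ps q x ξ)) = L := by
      funext q x ξ; simp only [Pi.mul_apply, L, hLam]
    rw [e1, e2] at h
    exact h
  intro i j k l
  have sT := SymC.conj hA hB hR sL i j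
  let F : Par T → ℝ → ℝ → ℝ := fun q x ξ => Tij b a T δ (mu q) ε i j q.1.2 x ξ
  have hF : (fun q x ξ => Real.exp (-(L q x ξ)) *
      (Dxi^[i] (Dx^[j] (fun q x ξ => Real.exp (L q x ξ)))) q x ξ) = F := by
    funext q x ξ
    rw [← pdXiX_eq]
    rfl
  rw [hF] at sT
  obtain ⟨C, hC, hfin⟩ := (SymC.iter_xi (SymC.iter_x sT l) k 0).bd
  refine ⟨C + 1, by positivity, fun μ t x ξ hμ0 hμ1 ht => ?_⟩
  have h := hfin ⟨(μ, t), hμ0, hμ1, ht⟩ x ξ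
  rw [← pdXiX_eq] at h
  set q : Par T := ⟨(μ, t), hμ0, hμ1, ht⟩ with hq
  have hbr : 0 < br μ ξ := hr0 q ξ
  have hphq : 0 < phi a δ μ x ξ := hph q x ξ
  have e : (B ^ k * (A ^ l * (R ^ (i + j) * A ^ j * B ^ i))) q x ξ =
      br μ ξ ^ ((2*δ/ν) * ((i : ℝ) + (j : ℝ))) *
            phi a δ μ x ξ ^ (-((j : ℝ) + (l : ℝ))/2) *
            br μ ξ ^ (-((i : ℝ) + (k : ℝ))) := by
    have eR : R q x ξ ^ (i + j) = br μ ξ ^ ((2*δ/ν) * ((i : ℝ) + (j : ℝ))) := by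
      change (br μ ξ ^ (2*δ/ν)) ^ (i+j) = _
      rw [← Real.rpow_natCast, ← Real.rpow_mul hbr.le]; push_cast; rfl
    have eA : A q x ξ ^ (l + j) = phi a δ μ x ξ ^ (-((j : ℝ) + (l : ℝ))/2) := by
      change ((Real.sqrt (phi a δ μ x ξ))⁻¹) ^ (l + j) = _
      rw [Real.sqrt_eq_rpow, ← Real.rpow_neg hphq.le, ← Real.rpow_natCast,
        ← Real.rpow_mul hphq.le]
      congr 1; push_cast; ring
    have eB : B q x ξ ^ (k + i) = br μ ξ ^ (-((i : ℝ) + (k : ℝ))) := by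
      change ((br μ ξ)⁻¹) ^ (k + i) = _
      rw [Real.rpow_neg hbr.le, ← Nat.cast_add, Real.rpow_natCast, inv_pow, add_comm]
    rw [← eR, ← eA, ← eB]
    simp only [Pi.mul_apply, Pi.pow_apply]
    ring
  rw [e] at h
  refine h.trans ?_
  have hX := Real.rpow_nonneg hbr.le ((2*δ/ν) * ((i : ℝ) + (j : ℝ)))
  have hY := Real.rpow_nonneg hphq.le (-((j : ℝ) + (l : ℝ))/2)
  have hZ := Real.rpow_nonneg hbr.le (-((i : ℝ) + (k : ℝ)))
  have hXYZ := mul_nonneg (mul_nonneg hX hY) hZ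
  refine (mul_le_mul_of_nonneg_right (show C ≤ C + 1 by linarith) hXYZ).trans (le_of_eq ?_)
  simp only [ν]
  ring
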